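/- arXiv:1608.01199 — 5 statements merged into one kernel-verified Lean document; each statement's English description precedes it below -/
import Mathlib

section
/- Let X be a Hausdorff topological space, f : X → X a continuous map, and P_0, P_1, …, P_n a finite sequence of nonempty compact connected subsets of X such that for each j < n the restriction of f to P_j is injective and P_{j+1} ⊆ f(P_j). Then the set ⋂_{j=0}^{n} (f^{[j]})⁻¹(P_j) = { x ∈ X : f^{[j]}(x) ∈ P_j for all 0 ≤ j ≤ n } is nonempty and connected (here f^{[j]} denotes the j-th iterate of f). -/
/-- The part of a compact set lying over a connected subset of its image under a continuous map
that is injective on the compact set is connected. -/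
theorem IsConnected.inter_preimage_of_injOn {X Y : Type*} [TopologicalSpace X]
    [TopologicalSpace Y] [T2Space Y] {f : X → Y} {K : Set X} {T : Set Y} (hT : IsConnected T)
    (hf : ContinuousOn f K) (hK : IsCompact K) (hinj : Set.InjOn f K) (hTK : T ⊆ f '' K) :
    IsConnected (K ∩ f ⁻¹' T) := by
  have : CompactSpace K := isCompact_iff_compactSpace.mp hK
  have h := (hT.preimage_of_isClosedMap hinj.injective hf.domRestrict.isClosedMap
    (by rwa [Set.range_domRestrict])).image Subtype.val continuous_subtype_val.continuousOn
  rwa [Set.domRestrict_eq, Set.preimage_comp, Subtype.image_preimage_coe] at h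

/-- Key step in the proof of Lemma 2.2: for a finite word of nonempty compact
connected pieces on which `f` is injective and which satisfy the Markov
surjectivity `P (j+1) ⊆ f '' P j`, the intersection of iterated preimages
`⋂_{j=0}^{n} f^{-[j]}(P j)` is nonempty and connected. -/
theorem stmt_0 {X : Type*} [TopologicalSpace X] [T2Space X]
    (f : X → X) (hf : Continuous f) (n : ℕ) (P : ℕ → Set X)
    (hne : ∀ j ≤ n, (P j).Nonempty)
    (hcomp : ∀ j ≤ n, IsCompact (P j))
    (hconn : ∀ j ≤ n, IsConnected (P j))
    (hinj : ∀ j < n, Set.InjOn f (P j))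
    (hsub : ∀ j < n, P (j + 1) ⊆ f '' P j) :
    IsConnected {x : X | ∀ j ≤ n, f^[j] x ∈ P j} := by
  induction n generalizing P with
  | zero => simpa using hconn 0 le_rfl
  | succ n ih =>
    have hT := ih (fun j => P (j + 1)) (fun j hj => hne _ (by lia)) (fun j hj => hcomp _ (by lia))
      (fun j hj => hconn _ (by lia)) (fun j hj => hinj _ (by lia)) (fun j hj => hsub _ (by lia))
    convert hT.inter_preimage_of_injOn hf.continuousOn (hcomp 0 (by lia)) (hinj 0 (by lia))
      (fun x hx => hsub 0 (by lia) (hx 0 (by lia))) using 1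
    ext x
    constructor
    · exact fun h => ⟨h 0 (by lia), fun j hj => h (j + 1) (by lia)⟩
    · rintro ⟨h0, h⟩ (_ | j) hj
      · exact h0
      · exact h j (by lia)
end

section
/- Under the hypotheses and definitions in the context, for every i ≥ 1 one has s_i + m_{i+1} > n_i (equivalently m_{i+1} > r_i); this is item 2 of Lemma 3.14: n_i − r_i + m_{i+1} > n_i for all i ≥ 1, so that in particular n_{i+1} > n_i. -/
/-- Lemma 3.14 context: sequences `m i`, `j i` with `m i ≥ 1`, `j i ≥ 1`,
`j 1 > 3·i₁`, `m (i+1) > j i · m i`, and the derived quantities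
`s i = n i - r i`, `n i`, `r i` of Section 3.13. -/
theorem stmt_13 (m j s n r : ℕ → ℤ) (i₁ : ℤ)
    (hm : ∀ i ≥ 1, 1 ≤ m i) (hj : ∀ i ≥ 1, 1 ≤ j i)
    (hi₁ : 1 ≤ i₁) (hj1 : j 1 > 3 * i₁)
    (hmm : ∀ i ≥ 1, m (i + 1) > j i * m i)
    (hs1 : s 1 = (j 1 - i₁) * m 1)
    (hs2 : s 2 = j 2 * m 2 - i₁ * m 1)
    (hs3 : s 3 = j 3 * m 3 + (j 1 - 2 * i₁) * m 1)
    (hs : ∀ i ≥ 4, s i = j i * m i + j (i - 2) * m (i - 2) - 2 * i₁ * m 1)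
    (hn1 : n 1 = j 1 * m 1)
    (hn : ∀ i ≥ 1, n (i + 1) = j (i + 1) * m (i + 1) + s i)
    (hr : ∀ i ≥ 1, r i = n i - s i) :
    ∀ i ≥ 1, s i + m (i + 1) > n i := by
  have hlt : ∀ i ≥ 1, j i * m i < j (i + 1) * m (i + 1) := fun i hi => by
    have h₁ := hm (i + 1) (by omega)
    have h₂ := hj (i + 1) (by omega)
    nlinarith [hmm i hi]
  have hm1 := hm 1 le_rfl
  have hi₁m : i₁ * m 1 < j 1 * m 1 := by nlinarith
  have hpos : 0 < i₁ * m 1 := by nlinarith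
  have hlt1 := hlt 1 le_rfl
  have hlt2 := hlt 2 (by omega)
  have hlt3 := hlt 3 (by omega)
  have hlt4 := hlt 4 (by omega)
  intro i hi
  have hmi := hmm i hi
  match i, hi with
  | 1, _ => linarith
  | 2, _ =>
    have hn2 := hn 1 le_rfl
    norm_num at *
    linarith
  | 3, _ =>
    have hn3 := hn 2 (by omega)
    norm_num at *
    linarith
  | 4, _ =>
    have hn4 := hn 3 (by omega)
    have hs4 := hs 4 le_rfl
    norm_num at *
    linarith
  | k + 5, _ =>
    have hnk : n (k + 5) = j (k + 5) * m (k + 5) + s (k + 4) := hn (k + 4) (by omega)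
    have hsk : s (k + 5) = j (k + 5) * m (k + 5) + j (k + 3) * m (k + 3) - 2 * i₁ * m 1 :=
      hs (k + 5) (by omega)
    have hsk' : s (k + 4) = j (k + 4) * m (k + 4) + j (k + 2) * m (k + 2) - 2 * i₁ * m 1 :=
      hs (k + 4) (by omega)
    have h₂ : j (k + 2) * m (k + 2) < j (k + 3) * m (k + 3) := hlt (k + 2) (by omega)
    have h₄ : j (k + 4) * m (k + 4) < j (k + 5) * m (k + 5) := hlt (k + 4) (by omega)
    linarith
end

section
/- Under the hypotheses and definitions in the context, for every i ≥ 2 one has r_i < m_i, i.e. n_i − s_i < m_i; this is item 3 of Lemma 3.14. -/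
/-- Lemma 3.14 context: sequences `m i`, `j i` with `m i ≥ 1`, `j i ≥ 1`,
`j 1 > 3·i₁`, `m (i+1) > j i · m i`, and the derived quantities
`s i = n i - r i`, `n i`, `r i` of Section 3.13. -/
theorem stmt_14 (m j s n r : ℕ → ℤ) (i₁ : ℤ)
    (hm : ∀ i ≥ 1, 1 ≤ m i) (hj : ∀ i ≥ 1, 1 ≤ j i)
    (hi₁ : 1 ≤ i₁) (hj1 : j 1 > 3 * i₁)
    (hmm : ∀ i ≥ 1, m (i + 1) > j i * m i)
    (hs1 : s 1 = (j 1 - i₁) * m 1)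
    (hs2 : s 2 = j 2 * m 2 - i₁ * m 1)
    (hs3 : s 3 = j 3 * m 3 + (j 1 - 2 * i₁) * m 1)
    (hs : ∀ i ≥ 4, s i = j i * m i + j (i - 2) * m (i - 2) - 2 * i₁ * m 1)
    (hn1 : n 1 = j 1 * m 1)
    (hn : ∀ i ≥ 1, n (i + 1) = j (i + 1) * m (i + 1) + s i)
    (hr : ∀ i ≥ 1, r i = n i - s i) :
    ∀ i ≥ 2, r i < m i := by
  have step : ∀ k ≥ 1, j k * m k < j (k + 1) * m (k + 1) := fun k hk =>
    (hmm k hk).trans_le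
      (le_mul_of_one_le_left (by linarith [hm (k + 1) (by lia)]) (hj (k + 1) (by lia)))
  intro i hi
  obtain rfl | rfl | rfl | h : i = 2 ∨ i = 3 ∨ i = 4 ∨ 5 ≤ i := by lia
  · linarith [hr 2 (by lia), hn 1 le_rfl, hmm 1 le_rfl]
  · have hpos : 0 < (j 1 - i₁) * m 1 :=
      mul_pos (by linarith) (by linarith [hm 1 le_rfl])
    linarith [hr 3 (by lia), hn 2 (by lia), hmm 2 (by lia)]
  · have h4 := hs 4 le_rfl
    norm_num at h4
    linarith [hr 4 (by lia), hn 3 (by lia), hmm 3 (by lia), step 1 le_rfl]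
  · obtain ⟨k, rfl⟩ := Nat.exists_eq_add_of_le' h
    have h4 : s (k + 4) = j (k + 4) * m (k + 4) + j (k + 2) * m (k + 2) - 2 * i₁ * m 1 :=
      hs (k + 4) (by lia)
    have h5 : s (k + 5) = j (k + 5) * m (k + 5) + j (k + 3) * m (k + 3) - 2 * i₁ * m 1 :=
      hs (k + 5) (by lia)
    linarith [hr (k + 5) (by lia), hn (k + 4) (by lia), hmm (k + 4) (by lia),
      step (k + 2) (by lia)]
end

section
/- Under the hypotheses and definitions in the context, for every i ≥ 1 one has s_{i+1} > s_i, i.e. n_{i+1} − r_{i+1} > n_i − r_i; this is item 4 of Lemma 3.14. -/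
/-- Lemma 3.14 context: sequences `m i`, `j i` with `m i ≥ 1`, `j i ≥ 1`,
`j 1 > 3·i₁`, `m (i+1) > j i · m i`, and the derived quantities
`s i = n i - r i`, `n i`, `r i` of Section 3.13. -/
theorem stmt_15 (m j s n r : ℕ → ℤ) (i₁ : ℤ)
    (hm : ∀ i ≥ 1, 1 ≤ m i) (hj : ∀ i ≥ 1, 1 ≤ j i)
    (hi₁ : 1 ≤ i₁) (hj1 : j 1 > 3 * i₁)
    (hmm : ∀ i ≥ 1, m (i + 1) > j i * m i)
    (hs1 : s 1 = (j 1 - i₁) * m 1)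
    (hs2 : s 2 = j 2 * m 2 - i₁ * m 1)
    (hs3 : s 3 = j 3 * m 3 + (j 1 - 2 * i₁) * m 1)
    (hs : ∀ i ≥ 4, s i = j i * m i + j (i - 2) * m (i - 2) - 2 * i₁ * m 1)
    (hn1 : n 1 = j 1 * m 1)
    (hn : ∀ i ≥ 1, n (i + 1) = j (i + 1) * m (i + 1) + s i)
    (hr : ∀ i ≥ 1, r i = n i - s i) :
    ∀ i ≥ 1, s (i + 1) > s i := by
  have ha : ∀ i ≥ 1, j i * m i < j (i + 1) * m (i + 1) := fun i hi =>
    (hmm i hi).trans_le <|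
      le_mul_of_one_le_left (by linarith [hm (i + 1) (by omega)]) (hj (i + 1) (by omega))
  intro i hi
  obtain rfl | rfl | rfl | h4 : i = 1 ∨ i = 2 ∨ i = 3 ∨ 4 ≤ i := by omega
  · have h := ha 1 le_rfl
    norm_num at h ⊢
    linarith
  · have h := ha 2 (by norm_num)
    have hpos : 0 < (j 1 - i₁) * m 1 :=
      mul_pos (by linarith) (by linarith [hm 1 le_rfl])
    norm_num at h ⊢
    linarith
  · have h := ha 3 (by norm_num)
    have h' := ha 1 le_rfl
    have h4 := hs 4 le_rfl
    norm_num at h h' h4 ⊢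
    linarith
  · obtain ⟨k, rfl⟩ := Nat.exists_eq_add_of_le' h4
    have h := ha (k + 4) hi
    have h' := ha (k + 2) (by omega)
    have e := hs (k + 4) h4
    have e' := hs (k + 4 + 1) (by omega)
    rw [show k + 4 - 2 = k + 2 by omega] at e
    rw [show k + 4 + 1 - 2 = k + 2 + 1 by omega] at e'
    linarith
end

section
/- Under the hypotheses and definitions in the context, and assuming additionally that m_{i+1} > j_i·m_i + j_{i−2}·m_{i−2} for all i ≥ 3 (item 6 of Lemma 3.14), one has s₃ > n₂ − i₁·m₁ (i.e. n₃ − r₃ > n₂ − r₁) and s_i > n_{i−1} (i.e. n_i − r_i > n_{i−1}) for every i ≥ 4; this is item 5 of Lemma 3.14. -/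
/-- Lemma 3.14 context: sequences `m i`, `j i` with `m i ≥ 1`, `j i ≥ 1`,
`j 1 > 3·i₁`, `m (i+1) > j i · m i`, and the derived quantities
`s i = n i - r i`, `n i`, `r i` of Section 3.13. -/
theorem stmt_16 (m j s n r : ℕ → ℤ) (i₁ : ℤ)
    (hm : ∀ i ≥ 1, 1 ≤ m i) (hj : ∀ i ≥ 1, 1 ≤ j i)
    (hi₁ : 1 ≤ i₁) (hj1 : j 1 > 3 * i₁)
    (hmm : ∀ i ≥ 1, m (i + 1) > j i * m i)
    (hs1 : s 1 = (j 1 - i₁) * m 1)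
    (hs2 : s 2 = j 2 * m 2 - i₁ * m 1)
    (hs3 : s 3 = j 3 * m 3 + (j 1 - 2 * i₁) * m 1)
    (hs : ∀ i ≥ 4, s i = j i * m i + j (i - 2) * m (i - 2) - 2 * i₁ * m 1)
    (hn1 : n 1 = j 1 * m 1)
    (hn : ∀ i ≥ 1, n (i + 1) = j (i + 1) * m (i + 1) + s i)
    (hr : ∀ i ≥ 1, r i = n i - s i)
    (h6 : ∀ i ≥ 3, m (i + 1) > j i * m i + j (i - 2) * m (i - 2)) :
    s 3 > n 2 - i₁ * m 1 ∧ ∀ i ≥ 4, s i > n (i - 1) := by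
  have hle : ∀ i ≥ 1, m i ≤ j i * m i := fun i hi =>
    le_mul_of_one_le_left (by linarith [hm i hi]) (hj i hi)
  have hm1 := hm 1 le_rfl
  have hlt : i₁ * m 1 < j 1 * m 1 := mul_lt_mul_of_pos_right (by linarith) (by linarith)
  have hmm1 := hmm 1 le_rfl
  have hle2 := hle 2 (by norm_num)
  refine ⟨?_, fun i hi => ?_⟩
  · have hn2 := hn 1 le_rfl
    have hmm2 := hmm 2 (by norm_num)
    have hle3 := hle 3 (by norm_num)
    norm_num at hn2 hmm2
    rw [hs3, hn2, hs1]
    linarith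
  · obtain ⟨k, rfl⟩ := Nat.exists_eq_add_of_le' hi
    have hsk := hs (k + 4) (by omega)
    have hnk := hn (k + 2) (by omega)
    have h6k := h6 (k + 3) (by omega)
    have hlek := hle (k + 4) (by omega)
    simp only [Nat.reduceSubDiff, Nat.add_assoc, Nat.reduceAdd]
      at hsk hnk h6k ⊢
    rw [hsk, hnk]
    match k with
    | 0 =>
      norm_num at *
      linarith
    | 1 =>
      norm_num at *
      linarith
    | l + 2 =>
      have hsl := hs (l + 4) (by omega)
      have hmml := hmm (l + 2) (by omega)
      have hlel := hle (l + 3) (by omega)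
      simp only [Nat.reduceSubDiff, Nat.add_assoc, Nat.reduceAdd] at hsl hmml h6k hlek ⊢
      rw [hsl]
      linarith
end
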